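/- Consider N ≥ 2 agents with matrices A₁,…,A_N ∈ ℝ^{n×n} and biases b₁,…,b_N ∈ ℝⁿ, Laplacians ℒ_C and ℒ_P of weighted undirected graphs on N nodes (not assumed connected individually), a Laplacian ℒ_I of a connected weighted undirected graph, and σ_I > 0. Let ℒ_cp = ℒ_C + ℒ_P be the Laplacian of the projection graph (whose adjacency matrix is the sum of the two adjacency matrices) and assume the projection graph is connected. Let Â = diag(A₁,…,A_N), B = (b₁ᵀ,…,b_Nᵀ)ᵀ, and define Ψ₁₁ = (1/N)·Σ_{k=1}^N A_k, μ = λ_max(Σ_{k=2}^N ((A_k + A_kᵀ) − (A₁ + A₁ᵀ))²), η = λ_max(Ψ₁₁ + Ψ₁₁ᵀ), ρ = max_k λ_max(A_k + A_kᵀ). Assume: (i) Ψ₁₁ is invertible and Ψ₁₁ + Ψ₁₁ᵀ is negative definite; (ii) λ₂(ℒ_cp) > (1/2)·(μ/(N·|η|) + ρ); (iii) λ₂(ℒ_I) > 0. Then for every continuously differentiable pair x : [0,∞) → ℝ^{nN}, z : [0,∞) → ℝ^{nN} satisfying ẋ(t) = (Â − (ℒ_cp ⊗ I_n))x(t) +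 z(t) + B and ż(t) = −σ_I·(ℒ_I ⊗ I_n)·x(t) with z(0) = 0, the state x(t) converges as t → ∞ to 𝟙_N ⊗ x_∞ with x_∞ = −(1/N)·Ψ₁₁⁻¹·Σ_{k=1}^N b_k, and z(t) remains bounded on [0,∞). -/

import Mathlib

open Matrix
open scoped Kronecker

noncomputable section

/-- The index `0` of `Fin N` when `N ≥ 2`. -/
def e0 {N : ℕ} (hN : 2 ≤ N) : Fin N := ⟨0, by omega⟩

/-- The embedding `Fin (N-1) → Fin N`, `i ↦ i + 1`. -/
def emb {N : ℕ} (hN : 2 ≤ N) (i : Fin (N - 1)) : Fin N :=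
  ⟨i.1 + 1, by have := i.2; omega⟩

/-- `L` is the Laplacian of a weighted undirected graph on `N` nodes. -/
def IsLaplacian {N : ℕ} (L : Matrix (Fin N) (Fin N) ℝ) : Prop :=
  ∃ A : Matrix (Fin N) (Fin N) ℝ, A.IsSymm ∧ (∀ i j, 0 ≤ A i j) ∧
    (∀ i, A i i = 0) ∧ L = Matrix.diagonal (fun i => ∑ j, A i j) - A

/-- `L` is the Laplacian of a *connected* weighted undirected graph: its
kernel is spanned by the all-ones vector. -/
def IsConnLaplacian {N : ℕ} (L : Matrix (Fin N) (Fin N) ℝ) : Prop :=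
  IsLaplacian L ∧ ∀ v : Fin N → ℝ, L.mulVec v = 0 → ∃ c : ℝ, v = fun _ => c

/-- The block-diagonal matrix `diag(A₁,…,A_N)` on `ℝ^{nN}`. -/
def blockDiag {N n : ℕ} (A : Fin N → Matrix (Fin n) (Fin n) ℝ) :
    Matrix (Fin N × Fin n) (Fin N × Fin n) ℝ :=
  Matrix.of fun p q => if p.1 = q.1 then A p.1 p.2 q.2 else 0

/-- The second-smallest eigenvalue of a graph Laplacian, characterised as
`min { vᵀLv : ‖v‖ = 1, vᵀ𝟙 = 0 }`. -/
def lambda2 {N : ℕ} (L : Matrix (Fin N) (Fin N) ℝ) : ℝ :=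
  sInf {r : ℝ | ∃ v : Fin N → ℝ,
    (∑ i, v i ^ 2) = 1 ∧ (∑ i, v i) = 0 ∧ r = v ⬝ᵥ L.mulVec v}

/-- The largest eigenvalue of a (symmetric) real matrix. -/
def lambdaMax {k : Type*} [Fintype k] (S : Matrix k k ℝ) : ℝ :=
  sSup {r : ℝ | ∃ v : k → ℝ, v ≠ 0 ∧ S.mulVec v = r • v}

section Spectral

variable {k : Type*} [Fintype k]

lemma finite_setOf_eigenvalue (S : Matrix k k ℝ) :
    {r : ℝ | ∃ v : k → ℝ, v ≠ 0 ∧ S *ᵥ v = r • v}.Finite := by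
  classical
  refine (Module.End.finite_hasEigenvalue (Matrix.toLin' S)).subset ?_
  rintro r ⟨v, hv, h⟩
  exact Module.End.hasEigenvalue_of_hasEigenvector
    ⟨Module.End.mem_eigenspace_iff.2 (by simpa using h), hv⟩

lemma exists_eigenvector_lambdaMax [Nonempty k] {S : Matrix k k ℝ} (hS : Sᵀ = S) :
    ∃ v : k → ℝ, v ≠ 0 ∧ S *ᵥ v = lambdaMax S • v := by
  classical
  have hH : S.IsHermitian := by simpa [Matrix.IsHermitian] using hS
  have hne : {r : ℝ | ∃ v : k → ℝ, v ≠ 0 ∧ S *ᵥ v = r • v}.Nonempty := by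
    obtain ⟨i⟩ := ‹Nonempty k›
    refine ⟨hH.eigenvalues i, _, ?_, hH.mulVec_eigenvectorBasis i⟩
    have := hH.eigenvectorBasis.toBasis.ne_zero i
    simpa using this
  exact hne.csSup_mem (finite_setOf_eigenvalue S)

lemma dotProduct_mulVec_le_lambdaMax {S : Matrix k k ℝ} (hS : Sᵀ = S) (v : k → ℝ) :
    v ⬝ᵥ S *ᵥ v ≤ lambdaMax S * (v ⬝ᵥ v) := by
  classical
  have hT : (lambdaMax S • (1 : Matrix k k ℝ) - S).IsHermitian := by
    simp [Matrix.IsHermitian, hS]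
  have hpsd : (lambdaMax S • (1 : Matrix k k ℝ) - S).PosSemidef := by
    refine hT.posSemidef_iff_eigenvalues_nonneg.2 fun i => ?_
    have h := hT.mulVec_eigenvectorBasis i
    have hne : (⇑(hT.eigenvectorBasis i) : k → ℝ) ≠ 0 := by
      have := hT.eigenvectorBasis.toBasis.ne_zero i
      simpa using this
    have hmem : lambdaMax S - hT.eigenvalues i ∈
        {r : ℝ | ∃ v : k → ℝ, v ≠ 0 ∧ S *ᵥ v = r • v} := by
      refine ⟨_, hne, ?_⟩
      rw [sub_smul, ← h, sub_mulVec, smul_mulVec, one_mulVec]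
      simp
    have := le_csSup (finite_setOf_eigenvalue S).bddAbove hmem
    change _ ≤ lambdaMax S at this
    simpa using this
  have := hpsd.dotProduct_mulVec_nonneg v
  simp only [star_trivial, sub_mulVec, smul_mulVec, one_mulVec, dotProduct_sub,
    dotProduct_smul, smul_eq_mul] at this
  linarith

lemma dotProduct_self_nonneg' (v : k → ℝ) : 0 ≤ v ⬝ᵥ v :=
  Finset.sum_nonneg fun i _ => mul_self_nonneg (v i)

lemma dotProduct_self_pos {v : k → ℝ} (hv : v ≠ 0) : 0 < v ⬝ᵥ v :=
  lt_of_le_of_ne (dotProduct_self_nonneg' v) fun h => hv (dotProduct_self_eq_zero.1 h.symm)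

lemma abs_dotProduct_le (u v : k → ℝ) : |u ⬝ᵥ v| ≤ (u ⬝ᵥ u + v ⬝ᵥ v) / 2 := by
  have h1 := dotProduct_self_nonneg' (u + v)
  have h2 := dotProduct_self_nonneg' (u - v)
  simp only [add_dotProduct, dotProduct_add, sub_dotProduct, dotProduct_sub] at h1 h2
  rw [dotProduct_comm v u] at h1 h2
  rw [abs_le]
  constructor <;> linarith

lemma dotProduct_mulVec_le_add_transpose (M : Matrix k k ℝ) (v : k → ℝ) :
    v ⬝ᵥ M *ᵥ v ≤ lambdaMax (M + Mᵀ) / 2 * (v ⬝ᵥ v) := by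
  have h := dotProduct_mulVec_le_lambdaMax (S := M + Mᵀ) (by simp [add_comm]) v
  rw [add_mulVec, dotProduct_add, dotProduct_transpose_mulVec] at h
  linarith

lemma exists_dotProduct_mulVec_le (M : Matrix k k ℝ) :
    ∃ C, 0 ≤ C ∧ ∀ v : k → ℝ, v ⬝ᵥ M *ᵥ v ≤ C * (v ⬝ᵥ v) := by
  refine ⟨max (lambdaMax (M + Mᵀ) / 2) 0, le_max_right _ _, fun v => ?_⟩
  exact (dotProduct_mulVec_le_add_transpose M v).trans
    (mul_le_mul_of_nonneg_right (le_max_left _ _) (dotProduct_self_nonneg' v))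

lemma lambdaMax_neg_of_posDef_neg [Nonempty k] {S : Matrix k k ℝ} (hS : (-S).PosDef) :
    lambdaMax S < 0 := by
  have hsymm : Sᵀ = S := by simpa [Matrix.IsHermitian] using hS.isHermitian
  obtain ⟨v, hv, h⟩ := exists_eigenvector_lambdaMax hsymm
  have h1 := hS.dotProduct_mulVec_pos hv
  simp only [star_trivial, neg_mulVec, h, dotProduct_neg, dotProduct_smul, smul_eq_mul] at h1
  have := dotProduct_self_pos hv
  by_contra! hc
  nlinarith

lemma Matrix.PosDef.exists_pos_le_dotProduct_mulVec {H : Matrix k k ℝ} (hH : H.PosDef) :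
    ∃ c, 0 < c ∧ ∀ v : k → ℝ, c * (v ⬝ᵥ v) ≤ v ⬝ᵥ H *ᵥ v := by
  rcases isEmpty_or_nonempty k with hk | hk
  · exact ⟨1, one_pos, fun v => by simp [dotProduct]⟩
  · refine ⟨-lambdaMax (-H), ?_, fun v => ?_⟩
    · have := lambdaMax_neg_of_posDef_neg (S := -H) (by simpa using hH)
      linarith
    · have hs : (-H)ᵀ = -H := by
        simpa [Matrix.IsHermitian] using hH.isHermitian
      have := dotProduct_mulVec_le_lambdaMax hs v
      rw [neg_mulVec, dotProduct_neg] at this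
      linarith

end Spectral

section Lyapunov

variable {ι : Type*} [Fintype ι]

lemma HasDerivWithinAt.dotProduct' {u v : ℝ → ι → ℝ} {u' v' : ι → ℝ} {s : Set ℝ} {t : ℝ}
    (hu : HasDerivWithinAt u u' s t) (hv : HasDerivWithinAt v v' s t) :
    HasDerivWithinAt (fun t => u t ⬝ᵥ v t) (u' ⬝ᵥ v t + u t ⬝ᵥ v') s t := by
  rw [hasDerivWithinAt_pi] at hu hv
  have := HasDerivWithinAt.fun_sum (u := Finset.univ) fun i _ => (hu i).mul (hv i)
  simpa [dotProduct, Finset.sum_add_distrib] using this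

lemma HasDerivWithinAt.matrix_mulVec {v : ℝ → ι → ℝ} {v' : ι → ℝ} {s : Set ℝ} {t : ℝ}
    (M : Matrix ι ι ℝ) (hv : HasDerivWithinAt v v' s t) :
    HasDerivWithinAt (fun t => M *ᵥ v t) (M *ᵥ v') s t := by
  rw [hasDerivWithinAt_pi] at hv ⊢
  intro i
  exact HasDerivWithinAt.fun_sum (u := Finset.univ) fun j _ => (hv j).const_mul (M i j)

lemma le_mul_exp_of_hasDerivWithinAt_le {V V' : ℝ → ℝ} {a : ℝ}
    (hV : ∀ t ∈ Set.Ici (0 : ℝ), HasDerivWithinAt V (V' t) (Set.Ici 0) t)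
    (hle : ∀ t ∈ Set.Ici (0 : ℝ), V' t ≤ -a * V t) :
    ∀ t ∈ Set.Ici (0 : ℝ), V t ≤ V 0 * Real.exp (-a * t) := by
  have hd : ∀ t ∈ Set.Ici (0 : ℝ), HasDerivWithinAt (fun t => Real.exp (a * t) * V t)
      (Real.exp (a * t) * a * V t + Real.exp (a * t) * V' t) (Set.Ici 0) t := by
    intro t ht
    have h1 : HasDerivAt (fun t => Real.exp (a * t)) (Real.exp (a * t) * a) t := by
      simpa using ((hasDerivAt_id t).const_mul a).exp
    exact h1.hasDerivWithinAt.mul (hV t ht)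
  have hanti : AntitoneOn (fun t => Real.exp (a * t) * V t) (Set.Ici 0) := by
    refine antitoneOn_of_hasDerivWithinAt_nonpos (convex_Ici 0)
      (fun t ht => (hd t ht).continuousWithinAt)
      (fun t ht => (hd t (interior_subset ht)).mono interior_subset) fun t ht => ?_
    have := hle t (interior_subset ht)
    nlinarith [Real.exp_pos (a * t)]
  intro t ht
  have h := hanti (Set.mem_Ici.2 le_rfl) ht ht
  simp only [mul_zero, Real.exp_zero, one_mul] at h
  rw [neg_mul, Real.exp_neg, ← div_eq_mul_inv, le_div_iff₀ (Real.exp_pos _)]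
  linarith

/-- Exponential decay for the system `ė = Q e + w`, `ẇ = -K e` when `Q` is negative definite and
the energy `½ wᵀ H w` exactly compensates the coupling term `wᵀ e`. -/
lemma exists_exp_bound_of_feedback {Q K H : Matrix ι ι ℝ} (hH : H.PosDef) {c : ℝ} (hc : 0 < c)
    (hQ : ∀ v, v ⬝ᵥ Q *ᵥ v ≤ -c * (v ⬝ᵥ v)) {e w : ℝ → ι → ℝ}
    (he : ∀ t ∈ Set.Ici (0 : ℝ), HasDerivWithinAt e (Q *ᵥ e t + w t) (Set.Ici 0) t)
    (hw : ∀ t ∈ Set.Ici (0 : ℝ), HasDerivWithinAt w (-(K *ᵥ e t)) (Set.Ici 0) t)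
    (hcomp : ∀ t ∈ Set.Ici (0 : ℝ), w t ⬝ᵥ H *ᵥ (K *ᵥ e t) = w t ⬝ᵥ e t) :
    ∃ C a, 0 < a ∧ ∀ t ∈ Set.Ici (0 : ℝ),
      e t ⬝ᵥ e t + w t ⬝ᵥ w t ≤ C * Real.exp (-a * t) := by
  obtain ⟨C1, hC1, h1⟩ := exists_dotProduct_mulVec_le (Qᵀ * Q)
  obtain ⟨C2, hC2, h2⟩ := exists_dotProduct_mulVec_le K
  obtain ⟨C3, hC3, h3⟩ := exists_dotProduct_mulVec_le H
  obtain ⟨h, hh, h4⟩ := hH.exists_pos_le_dotProduct_mulVec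
  have hsymm : Hᵀ = H := by simpa [Matrix.IsHermitian] using hH.isHermitian
  have h1' : ∀ v, (Q *ᵥ v) ⬝ᵥ (Q *ᵥ v) ≤ C1 * (v ⬝ᵥ v) := by
    intro v
    have := h1 v
    rwa [← mulVec_mulVec, dotProduct_transpose_mulVec] at this
  obtain ⟨δ, hδ, hδ1, hδ2, hδ3⟩ : ∃ δ : ℝ, 0 < δ ∧ δ ≤ 1 / 2 ∧ δ ≤ h / 2 ∧
      δ * (C1 / 2 + C2) ≤ c / 2 := by
    refine ⟨min (1 / 2) (min (h / 2) (c / 2 / (C1 / 2 + C2 + 1))), by positivity,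
      min_le_left _ _, (min_le_right _ _).trans (min_le_left _ _), ?_⟩
    have hle : min (1 / 2) (min (h / 2) (c / 2 / (C1 / 2 + C2 + 1))) ≤
      c / 2 / (C1 / 2 + C2 + 1) := (min_le_right _ _).trans (min_le_right _ _)
    have hp : 0 < C1 / 2 + C2 + 1 := by positivity
    rw [le_div_iff₀ hp] at hle
    have : 0 < min (1 / 2) (min (h / 2) (c / 2 / (C1 / 2 + C2 + 1))) := by positivity
    nlinarith
  set V : ℝ → ℝ := fun t => (1 / 2) * (e t ⬝ᵥ e t) + (1 / 2) * (w t ⬝ᵥ H *ᵥ w t) -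
    δ * (e t ⬝ᵥ w t) with hVdef
  set V' : ℝ → ℝ := fun t => e t ⬝ᵥ Q *ᵥ e t -
    δ * ((Q *ᵥ e t) ⬝ᵥ w t + w t ⬝ᵥ w t - e t ⬝ᵥ K *ᵥ e t) with hV'def
  have hV : ∀ t ∈ Set.Ici (0 : ℝ), HasDerivWithinAt V (V' t) (Set.Ici 0) t := by
    intro t ht
    have d1 := ((he t ht).dotProduct' (he t ht)).const_mul (1 / 2)
    have d2 := ((hw t ht).dotProduct' ((hw t ht).matrix_mulVec H)).const_mul (1 / 2)
    have d3 := ((he t ht).dotProduct' (hw t ht)).const_mul δ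
    refine ((d1.add d2).sub d3).congr_deriv ?_
    have hs : (K *ᵥ e t) ⬝ᵥ H *ᵥ w t = w t ⬝ᵥ e t := by
      rw [← hcomp t ht, ← dotProduct_transpose_mulVec, hsymm]
    simp only [hV'def, neg_dotProduct, mulVec_neg, dotProduct_neg, hs, hcomp t ht,
      add_dotProduct, dotProduct_add]
    rw [dotProduct_comm (Q *ᵥ e t) (e t), dotProduct_comm (w t) (e t)]
    ring
  set m : ℝ := min 1 h / 4 with hm
  have hmpos : 0 < m := by positivity
  have hVlow : ∀ t, m * (e t ⬝ᵥ e t + w t ⬝ᵥ w t) ≤ V t := by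
    intro t
    have a1 := h4 (w t)
    have a2 := (abs_le.1 (abs_dotProduct_le (e t) (w t))).2
    have a3 := dotProduct_self_nonneg' (e t)
    have a4 := dotProduct_self_nonneg' (w t)
    have m1 : m ≤ 1 / 4 := by rw [hm]; linarith [min_le_left 1 h]
    have m2 : m ≤ h / 4 := by rw [hm]; linarith [min_le_right 1 h]
    simp only [hVdef]
    nlinarith [mul_le_mul_of_nonneg_left a2 hδ.le, mul_le_mul_of_nonneg_right m1 a3,
      mul_le_mul_of_nonneg_right m2 a4, mul_le_mul_of_nonneg_right hδ1 a3,
      mul_le_mul_of_nonneg_right hδ2 a4]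
  set C4 : ℝ := 1 + C3 with hC4
  have hVup : ∀ t, V t ≤ C4 * (e t ⬝ᵥ e t + w t ⬝ᵥ w t) := by
    intro t
    have a1 := h3 (w t)
    have a2 := (abs_le.1 (abs_dotProduct_le (e t) (w t))).1
    have a3 := dotProduct_self_nonneg' (e t)
    have a4 := dotProduct_self_nonneg' (w t)
    simp only [hVdef, hC4]
    nlinarith [mul_le_mul_of_nonneg_left a2 hδ.le, mul_le_mul_of_nonneg_right hδ1 a3,
      mul_le_mul_of_nonneg_right hδ1 a4, mul_nonneg hC3 a3, mul_nonneg hC3 a4]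
  set κ : ℝ := min c δ / 2 with hκ
  have hκpos : 0 < κ := by positivity
  have hV'le : ∀ t, V' t ≤ -κ * (e t ⬝ᵥ e t + w t ⬝ᵥ w t) := by
    intro t
    have a1 := h1' (e t)
    have a2 := (abs_le.1 (abs_dotProduct_le (Q *ᵥ e t) (w t))).1
    have a3 := dotProduct_self_nonneg' (e t)
    have a4 := dotProduct_self_nonneg' (w t)
    have a5 := h2 (e t)
    have a6 := hQ (e t)
    have k1 : κ ≤ c / 2 := by rw [hκ]; linarith [min_le_left c δ]
    have k2 : κ ≤ δ / 2 := by rw [hκ]; linarith [min_le_right c δ]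
    simp only [hV'def]
    nlinarith [mul_le_mul_of_nonneg_left a2 hδ.le, mul_le_mul_of_nonneg_right k1 a3,
      mul_le_mul_of_nonneg_right k2 a4, mul_le_mul_of_nonneg_right hδ3 a3,
      mul_le_mul_of_nonneg_left a1 hδ.le, mul_le_mul_of_nonneg_left a5 hδ.le]
  have hC4pos : 0 < C4 := by positivity
  have key := le_mul_exp_of_hasDerivWithinAt_le (a := κ / C4) hV fun t _ => by
    refine (hV'le t).trans ?_
    have : κ / C4 * V t ≤ κ / C4 * (C4 * (e t ⬝ᵥ e t + w t ⬝ᵥ w t)) :=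
      mul_le_mul_of_nonneg_left (hVup t) (by positivity)
    rw [← mul_assoc, div_mul_cancel₀ _ hC4pos.ne'] at this
    linarith
  refine ⟨V 0 / m, κ / C4, by positivity, fun t ht => ?_⟩
  rw [div_mul_eq_mul_div, le_div_iff₀ hmpos]
  linarith [hVlow t, key t ht]

end Lyapunov

section Graph

variable {N n : ℕ}

lemma kronecker_one_mulVec_apply (L : Matrix (Fin N) (Fin N) ℝ) (v : Fin N × Fin n → ℝ)
    (p : Fin N × Fin n) :
    ((L ⊗ₖ (1 : Matrix (Fin n) (Fin n) ℝ)) *ᵥ v) p = (L *ᵥ fun k => v (k, p.2)) p.1 := by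
  simp [mulVec, dotProduct, Fintype.sum_prod_type, Matrix.one_apply]

lemma blockDiag_mulVec_apply (A : Fin N → Matrix (Fin n) (Fin n) ℝ) (v : Fin N × Fin n → ℝ)
    (p : Fin N × Fin n) :
    (_root_.blockDiag A *ᵥ v) p = (A p.1 *ᵥ fun j => v (p.1, j)) p.2 := by
  simp [mulVec, dotProduct, Fintype.sum_prod_type, _root_.blockDiag]

lemma dotProduct_kronecker_one_mulVec (L : Matrix (Fin N) (Fin N) ℝ)
    (u v : Fin N × Fin n → ℝ) :
    u ⬝ᵥ (L ⊗ₖ (1 : Matrix (Fin n) (Fin n) ℝ)) *ᵥ v =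
      ∑ j, (fun k => u (k, j)) ⬝ᵥ L *ᵥ fun k => v (k, j) := by
  rw [dotProduct, Fintype.sum_prod_type_right]
  simp [kronecker_one_mulVec_apply, dotProduct]

lemma dotProduct_blockDiag_mulVec (A : Fin N → Matrix (Fin n) (Fin n) ℝ)
    (u v : Fin N × Fin n → ℝ) :
    u ⬝ᵥ _root_.blockDiag A *ᵥ v =
      ∑ k, (fun j => u (k, j)) ⬝ᵥ A k *ᵥ fun j => v (k, j) := by
  rw [dotProduct, Fintype.sum_prod_type]
  simp [blockDiag_mulVec_apply, dotProduct]

lemma IsLaplacian.transpose_eq {L : Matrix (Fin N) (Fin N) ℝ} (h : IsLaplacian L) : Lᵀ = L := by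
  obtain ⟨A, hs, -, -, rfl⟩ := h
  simp [hs.eq]

lemma IsLaplacian.mulVec_const {L : Matrix (Fin N) (Fin N) ℝ} (h : IsLaplacian L) (c : ℝ) :
    L *ᵥ (fun _ => c) = 0 := by
  obtain ⟨A, -, -, -, rfl⟩ := h
  ext i
  rw [sub_mulVec, Pi.sub_apply, mulVec_diagonal]
  simp [mulVec, dotProduct, Finset.sum_mul]

lemma IsLaplacian.add {L M : Matrix (Fin N) (Fin N) ℝ} (hL : IsLaplacian L)
    (hM : IsLaplacian M) : IsLaplacian (L + M) := by
  obtain ⟨A, hA1, hA2, hA3, rfl⟩ := hL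
  obtain ⟨B, hB1, hB2, hB3, rfl⟩ := hM
  refine ⟨A + B, hA1.add hB1, fun i j => add_nonneg (hA2 i j) (hB2 i j), fun i => ?_, ?_⟩
  · simp [hA3, hB3]
  · rw [sub_add_sub_comm, diagonal_add]
    simp [Finset.sum_add_distrib]

lemma IsLaplacian.dotProduct_mulVec_nonneg {L : Matrix (Fin N) (Fin N) ℝ} (h : IsLaplacian L)
    (v : Fin N → ℝ) : 0 ≤ v ⬝ᵥ L *ᵥ v := by
  obtain ⟨A, hs, hpos, -, rfl⟩ := h
  have h1 : v ⬝ᵥ (diagonal (fun i => ∑ j, A i j) - A) *ᵥ v =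
      ∑ i, ∑ j, A i j * (v i * v i - v i * v j) := by
    simp only [dotProduct, sub_mulVec, Pi.sub_apply, mulVec_diagonal]
    refine Finset.sum_congr rfl fun i _ => ?_
    simp only [mulVec, dotProduct, mul_sub, Finset.sum_sub_distrib, Finset.mul_sum,
      Finset.sum_mul]
    congr 1 <;> exact Finset.sum_congr rfl fun j _ => by ring
  have h2 : ∑ i, ∑ j, A i j * (v i * v i - v i * v j) =
      ∑ i, ∑ j, A i j * (v j * v j - v i * v j) := by
    rw [Finset.sum_comm]
    refine Finset.sum_congr rfl fun i _ => Finset.sum_congr rfl fun j _ => ?_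
    rw [hs.apply i j]
    ring
  have h3 : 0 ≤ ∑ i, ∑ j, A i j * (v i * v i - v i * v j) +
      ∑ i, ∑ j, A i j * (v j * v j - v i * v j) := by
    rw [← Finset.sum_add_distrib]
    refine Finset.sum_nonneg fun i _ => ?_
    rw [← Finset.sum_add_distrib]
    refine Finset.sum_nonneg fun j _ => ?_
    nlinarith [mul_nonneg (hpos i j) (sq_nonneg (v i - v j))]
  rw [h1]
  linarith

lemma IsLaplacian.lambda2_mul_le {L : Matrix (Fin N) (Fin N) ℝ} (h : IsLaplacian L)
    {v : Fin N → ℝ} (hv : ∑ i, v i = 0) : lambda2 L * (v ⬝ᵥ v) ≤ v ⬝ᵥ L *ᵥ v := by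
  by_cases h0 : v = 0
  · simp [h0]
  have hp := dotProduct_self_pos h0
  have hs : √(v ⬝ᵥ v) * √(v ⬝ᵥ v) = v ⬝ᵥ v := Real.mul_self_sqrt hp.le
  have hs0 : √(v ⬝ᵥ v) ≠ 0 := (Real.sqrt_pos.2 hp).ne'
  have hmem : lambda2 L ≤ (v ⬝ᵥ L *ᵥ v) / (v ⬝ᵥ v) := by
    refine csInf_le ⟨0, ?_⟩ ⟨(√(v ⬝ᵥ v))⁻¹ • v, ?_, ?_, ?_⟩
    · rintro r ⟨w, -, -, rfl⟩
      exact h.dotProduct_mulVec_nonneg w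
    · simp only [Pi.smul_apply, smul_eq_mul, mul_pow, ← Finset.mul_sum]
      have : ∑ i, v i ^ 2 = v ⬝ᵥ v := by simp [dotProduct, sq]
      rw [this, inv_pow, sq, hs, inv_mul_cancel₀ hp.ne']
    · simp [← Finset.mul_sum, hv]
    · rw [mulVec_smul, smul_dotProduct, dotProduct_smul, smul_smul, ← mul_inv, hs, smul_eq_mul,
        div_eq_inv_mul]
  rwa [le_div_iff₀ hp] at hmem

/-- The all-ones matrix regularises a Laplacian with positive algebraic connectivity. -/
lemma IsLaplacian.posDef_add_ones {L : Matrix (Fin N) (Fin N) ℝ} (h : IsLaplacian L)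
    (hpos : 0 < lambda2 L) : (L + of fun _ _ => (1 : ℝ)).PosDef := by
  refine .of_dotProduct_mulVec_pos ?_ fun v hv => ?_
  · have : (of fun _ _ => (1 : ℝ) : Matrix (Fin N) (Fin N) ℝ)ᵀ = of fun _ _ => (1 : ℝ) := rfl
    simp only [Matrix.IsHermitian, conjTranspose_eq_transpose_of_trivial, transpose_add,
      h.transpose_eq, this]
  · have h1 : v ⬝ᵥ (of fun _ _ => (1 : ℝ)) *ᵥ v = (∑ i, v i) ^ 2 := by
      simp [mulVec, dotProduct, ← Finset.sum_mul, sq]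
    rw [star_trivial, add_mulVec, dotProduct_add, h1]
    by_cases hs : ∑ i, v i = 0
    · have := h.lambda2_mul_le hs
      have := mul_pos hpos (dotProduct_self_pos hv)
      rw [hs]
      linarith
    · have := h.dotProduct_mulVec_nonneg v
      positivity

/-- A positive definite `G` inverting the Laplacian on mean-zero vectors. -/
lemma IsLaplacian.exists_posDef_mul_eq {L : Matrix (Fin N) (Fin N) ℝ} (h : IsLaplacian L)
    (hN : N ≠ 0) (hpos : 0 < lambda2 L) :
    ∃ G : Matrix (Fin N) (Fin N) ℝ, G.PosDef ∧
      G * L = 1 - (N : ℝ)⁻¹ • of fun _ _ => (1 : ℝ) := by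
  have hP := h.posDef_add_ones hpos
  set J : Matrix (Fin N) (Fin N) ℝ := of fun _ _ => (1 : ℝ) with hJ
  have hN' : (N : ℝ) ≠ 0 := by exact_mod_cast hN
  refine ⟨(L + J)⁻¹, hP.inv, ?_⟩
  have hu : IsUnit (L + J).det := isUnit_iff_ne_zero.2 hP.det_pos.ne'
  have hLJ : L * J = 0 := by
    ext i j
    have := congrFun (h.mulVec_const 1) i
    simpa [mul_apply, mulVec, dotProduct, hJ] using this
  have hJJ : J * J = (N : ℝ) • J := by
    ext i j
    simp [mul_apply, hJ]
  have hGJ : (L + J)⁻¹ * J = (N : ℝ)⁻¹ • J := by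
    have h1 : (L + J) * J = (N : ℝ) • J := by rw [add_mul, hLJ, hJJ, zero_add]
    have h2 := congrArg ((L + J)⁻¹ * ·) h1
    simp only [nonsing_inv_mul_cancel_left _ _ hu] at h2
    rw [eq_inv_smul_iff₀ hN', ← Matrix.mul_smul]
    exact h2.symm
  have h3 : (L + J)⁻¹ * (L + J) = 1 := nonsing_inv_mul _ hu
  rw [mul_add, hGJ] at h3
  exact eq_sub_of_add_eq h3

lemma sum_eq_e0_add_sum_emb (hN : 2 ≤ N) (f : Fin N → ℝ) :
    ∑ k, f k = f (e0 hN) + ∑ j, f (emb hN j) := by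
  obtain ⟨m, rfl⟩ : ∃ m, N = m + 1 := ⟨N - 1, by omega⟩
  exact Fin.sum_univ_succ f

lemma dotProduct_le_weighted {k : Type*} [Fintype k] {s : ℝ} (hs : 0 < s) (u v : k → ℝ) :
    u ⬝ᵥ v ≤ s / 2 * (u ⬝ᵥ u) + 1 / (2 * s) * (v ⬝ᵥ v) := by
  have h := dotProduct_self_nonneg' (s • u - v)
  simp only [sub_dotProduct, dotProduct_sub, smul_dotProduct, dotProduct_smul,
    smul_eq_mul, dotProduct_comm v u] at h
  have h2 : s / 2 * (u ⬝ᵥ u) + 1 / (2 * s) * (v ⬝ᵥ v) - u ⬝ᵥ v =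
      1 / (2 * s) * (s * (s * (u ⬝ᵥ u)) - s * (u ⬝ᵥ v) - (s * (u ⬝ᵥ v) - v ⬝ᵥ v)) := by
    field_simp
    ring
  have : 0 ≤ 1 / (2 * s) * (s * (s * (u ⬝ᵥ u)) - s * (u ⬝ᵥ v) - (s * (u ⬝ᵥ v) - v ⬝ᵥ v)) :=
    mul_nonneg (by positivity) (by linarith)
  linarith

lemma dotProduct_sum_sq_mulVec {ι k : Type*} [Fintype ι] [Fintype k] [DecidableEq k]
    {D : ι → Matrix k k ℝ} (hD : ∀ i, (D i)ᵀ = D i) (u : k → ℝ) :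
    u ⬝ᵥ (∑ i, D i ^ 2) *ᵥ u = ∑ i, (D i *ᵥ u) ⬝ᵥ (D i *ᵥ u) := by
  rw [sum_mulVec, dotProduct_sum]
  refine Finset.sum_congr rfl fun i _ => ?_
  nth_rw 1 [sq, ← mulVec_mulVec, ← hD i]
  rw [dotProduct_transpose_mulVec]

lemma lambdaMax_sum_sq_nonneg {ι k : Type*} [Fintype ι] [Fintype k] [Nonempty k] [DecidableEq k]
    {D : ι → Matrix k k ℝ} (hD : ∀ i, (D i)ᵀ = D i) : 0 ≤ lambdaMax (∑ i, D i ^ 2) := by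
  obtain ⟨v, hv, h⟩ := exists_eigenvector_lambdaMax (S := ∑ i, D i ^ 2)
    (by simp [transpose_sum, transpose_pow, hD])
  have h1 := dotProduct_sum_sq_mulVec hD v
  rw [h, dotProduct_smul, smul_eq_mul] at h1
  have h2 : 0 ≤ ∑ i, (D i *ᵥ v) ⬝ᵥ (D i *ᵥ v) :=
    Finset.sum_nonneg fun i _ => dotProduct_self_nonneg' _
  have := dotProduct_self_pos hv
  by_contra! hc
  nlinarith

lemma exists_dotProduct_closedLoop_le (hN : 2 ≤ N) (hn : 1 ≤ n)
    (A : Fin N → Matrix (Fin n) (Fin n) ℝ) {L : Matrix (Fin N) (Fin N) ℝ}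
    (hL : IsLaplacian L) {Ψ : Matrix (Fin n) (Fin n) ℝ} (hΨ : Ψ = (1 / (N : ℝ)) • ∑ k, A k)
    (hneg : (-(Ψ + Ψᵀ)).PosDef)
    {μ ρ : ℝ}
    (hμ : μ = lambdaMax (∑ j : Fin (N - 1),
      ((A (emb hN j) + (A (emb hN j))ᵀ) - (A (e0 hN) + (A (e0 hN))ᵀ)) ^ 2))
    (hρ : ∀ k, lambdaMax (A k + (A k)ᵀ) ≤ ρ)
    (hgap : (1 / 2) * (μ / (N * |lambdaMax (Ψ + Ψᵀ)|) + ρ) < lambda2 L) :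
    ∃ c, 0 < c ∧ ∀ v : Fin N × Fin n → ℝ,
      v ⬝ᵥ (_root_.blockDiag A - L ⊗ₖ (1 : Matrix (Fin n) (Fin n) ℝ)) *ᵥ v ≤ -c * (v ⬝ᵥ v) := by
  have : Nonempty (Fin n) := ⟨⟨0, hn⟩⟩
  have hNpos : (0 : ℝ) < N := by exact_mod_cast (by omega : 0 < N)
  set S : Fin N → Matrix (Fin n) (Fin n) ℝ := fun k => A k + (A k)ᵀ with hS
  have hSt : ∀ k, (S k)ᵀ = S k := fun k => by simp [hS, add_comm]
  set D : Fin (N - 1) → Matrix (Fin n) (Fin n) ℝ := fun j => S (emb hN j) - S (e0 hN) with hD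
  have hDt : ∀ j, (D j)ᵀ = D j := fun j => by simp [hD, hSt]
  have hμ' : μ = lambdaMax (∑ j, D j ^ 2) := hμ
  have hμ0 : 0 ≤ μ := hμ' ▸ lambdaMax_sum_sq_nonneg hDt
  set η := lambdaMax (Ψ + Ψᵀ) with hη
  have hη0 : η < 0 := lambdaMax_neg_of_posDef_neg hneg
  rw [abs_of_neg hη0] at hgap
  have hNη : 0 < N * -η := by nlinarith
  obtain ⟨s, hs1, hs2⟩ : ∃ s, μ / (N * -η) < s ∧ s < 2 * lambda2 L - ρ :=
    exists_between (by linarith)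
  have hs : 0 < s := lt_of_le_of_lt (by positivity) hs1
  set α : ℝ := N * -η / 2 - μ / (2 * s) with hα
  have hαpos : 0 < α := by
    rw [div_lt_iff₀ hNη] at hs1
    have : μ / (2 * s) < N * -η / 2 := by
      rw [div_lt_div_iff₀ (by positivity) (by positivity)]
      linarith
    linarith
  set β : ℝ := lambda2 L - ρ / 2 - s / 2 with hβ
  have hβpos : 0 < β := by linarith
  refine ⟨min (α / N) β, by positivity, fun e => ?_⟩
  set u : Fin n → ℝ := fun j => (N : ℝ)⁻¹ * ∑ k, e (k, j) with hu
  set d : Fin N → Fin n → ℝ := fun k j => e (k, j) - u j with hd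
  have hed : ∀ k, (fun j => e (k, j)) = u + d k := fun k => by ext j; simp [hd]
  have hdsum : ∑ k, d k = 0 := by
    ext j
    simp only [hd, hu, Finset.sum_apply, Finset.sum_sub_distrib, Finset.sum_const,
      Finset.card_univ, Fintype.card_fin, nsmul_eq_mul, Pi.zero_apply]
    rw [mul_inv_cancel_left₀ hNpos.ne', sub_self]
  set U := u ⬝ᵥ u with hU
  set E := ∑ k, d k ⬝ᵥ d k with hE
  have hU0 : 0 ≤ U := dotProduct_self_nonneg' _
  have hE0 : 0 ≤ E := Finset.sum_nonneg fun k _ => dotProduct_self_nonneg' _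
  have hnorm : e ⬝ᵥ e = N * U + E := by
    have h1 : e ⬝ᵥ e = ∑ k, (u + d k) ⬝ᵥ (u + d k) := by
      rw [dotProduct, Fintype.sum_prod_type]
      refine Finset.sum_congr rfl fun k _ => ?_
      rw [← hed k]
      rfl
    rw [h1]
    simp only [add_dotProduct, dotProduct_add, Finset.sum_add_distrib, ← dotProduct_sum,
      ← sum_dotProduct, hdsum]
    have h2 : ∑ _k : Fin N, u = (N : ℝ) • u := by ext; simp
    rw [h2, dotProduct_smul]
    simp [hE, hU]
  have hlap : lambda2 L * E ≤ e ⬝ᵥ (L ⊗ₖ (1 : Matrix (Fin n) (Fin n) ℝ)) *ᵥ e := by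
    have hE' : E = ∑ j, (fun k => d k j) ⬝ᵥ (fun k => d k j) := by
      simp only [hE, dotProduct]
      exact Finset.sum_comm
    rw [dotProduct_kronecker_one_mulVec, hE', Finset.mul_sum]
    refine Finset.sum_le_sum fun j _ => ?_
    have h1 : (fun k => e (k, j)) = (fun _ => u j) + fun k => d k j := by
      ext k; simp [hd]
    have h2 : (fun _ => u j) ⬝ᵥ L *ᵥ (fun k => d k j) = 0 := by
      rw [← hL.transpose_eq, dotProduct_transpose_mulVec, hL.mulVec_const, dotProduct_zero]
    rw [h1, mulVec_add, hL.mulVec_const, zero_add, add_dotProduct, h2, zero_add]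
    refine hL.lambda2_mul_le ?_
    simpa using congrFun hdsum j
  have hmean : ∑ k, u ⬝ᵥ A k *ᵥ u ≤ N * η / 2 * U := by
    have h1 : ∑ k, u ⬝ᵥ A k *ᵥ u = N * (u ⬝ᵥ Ψ *ᵥ u) := by
      rw [hΨ, smul_mulVec, dotProduct_smul, sum_mulVec, dotProduct_sum, smul_eq_mul, one_div,
        mul_inv_cancel_left₀ hNpos.ne']
    have h2 := dotProduct_mulVec_le_add_transpose Ψ u
    rw [h1]
    nlinarith
  have hdisp : ∑ k, d k ⬝ᵥ A k *ᵥ d k ≤ ρ / 2 * E := by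
    rw [hE, Finset.mul_sum]
    refine Finset.sum_le_sum fun k _ => (dotProduct_mulVec_le_add_transpose (A k) (d k)).trans ?_
    exact mul_le_mul_of_nonneg_right (by linarith [hρ k]) (dotProduct_self_nonneg' _)
  have hcross : ∑ k, d k ⬝ᵥ S k *ᵥ u ≤ s / 2 * E + μ / (2 * s) * U := by
    have h1 : ∑ k, d k ⬝ᵥ S k *ᵥ u = ∑ k, d k ⬝ᵥ (S k - S (e0 hN)) *ᵥ u := by
      simp only [sub_mulVec, dotProduct_sub, Finset.sum_sub_distrib, ← sum_dotProduct, hdsum,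
        zero_dotProduct, sub_zero]
    have h2 : ∑ j, d (emb hN j) ⬝ᵥ D j *ᵥ u ≤
        ∑ j, (s / 2 * (d (emb hN j) ⬝ᵥ d (emb hN j)) +
          1 / (2 * s) * ((D j *ᵥ u) ⬝ᵥ (D j *ᵥ u))) :=
      Finset.sum_le_sum fun j _ => dotProduct_le_weighted hs _ _
    rw [Finset.sum_add_distrib, ← Finset.mul_sum, ← Finset.mul_sum,
      ← dotProduct_sum_sq_mulVec hDt] at h2
    have h3 : u ⬝ᵥ (∑ j, D j ^ 2) *ᵥ u ≤ μ * U :=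
      hμ' ▸ dotProduct_mulVec_le_lambdaMax (by simp [transpose_sum, transpose_pow, hDt]) u
    have h4 : ∑ j, d (emb hN j) ⬝ᵥ d (emb hN j) ≤ E := by
      rw [hE, sum_eq_e0_add_sum_emb hN]
      linarith [dotProduct_self_nonneg' (d (e0 hN))]
    have h5 : 1 / (2 * s) * (u ⬝ᵥ (∑ j, D j ^ 2) *ᵥ u) ≤ 1 / (2 * s) * (μ * U) :=
      mul_le_mul_of_nonneg_left h3 (by positivity)
    have h6 : 1 / (2 * s) * (μ * U) = μ / (2 * s) * U := by ring
    rw [h1, sum_eq_e0_add_sum_emb hN, sub_self, zero_mulVec, dotProduct_zero, zero_add]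
    nlinarith
  have hblock : e ⬝ᵥ _root_.blockDiag A *ᵥ e =
      ∑ k, u ⬝ᵥ A k *ᵥ u + ∑ k, d k ⬝ᵥ S k *ᵥ u + ∑ k, d k ⬝ᵥ A k *ᵥ d k := by
    rw [dotProduct_blockDiag_mulVec, ← Finset.sum_add_distrib, ← Finset.sum_add_distrib]
    refine Finset.sum_congr rfl fun k _ => ?_
    rw [hed k]
    simp only [hS, add_mulVec, mulVec_add, add_dotProduct, dotProduct_add,
      dotProduct_transpose_mulVec]
    ring
  rw [sub_mulVec, dotProduct_sub, hblock, hnorm]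
  have hc1 : min (α / N) β * (N * U) ≤ α * U := by
    have := mul_le_mul_of_nonneg_right (min_le_left (α / N) β) (mul_nonneg hNpos.le hU0)
    rwa [← mul_assoc (α / N), div_mul_cancel₀ _ hNpos.ne'] at this
  have hc2 := mul_le_mul_of_nonneg_right (min_le_right (α / N) β) hE0
  have : α * U = N * -η / 2 * U - μ / (2 * s) * U := by rw [hα]; ring
  have : β * E = lambda2 L * E - ρ / 2 * E - s / 2 * E := by rw [hβ]; ring
  linarith

end Graph

/-- Corollary 12 of the paper: if the projection graph of the open-loop and
proportional layers is connected, conditions (i), (iii) together with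
`λ₂(ℒ_cp) > (1/2)(μ/(N|η|) + ρ)` guarantee convergence of every trajectory of
the closed-loop network to `𝟙_N ⊗ x_∞` and boundedness of `z`. -/
theorem stmt_13 {N n : ℕ} (hN : 2 ≤ N) (hn : 1 ≤ n)
    (A : Fin N → Matrix (Fin n) (Fin n) ℝ) (b : Fin N → Fin n → ℝ)
    (LC LP LI : Matrix (Fin N) (Fin N) ℝ)
    (hLC : IsLaplacian LC) (hLP : IsLaplacian LP)
    (hLI : IsConnLaplacian LI)
    -- the projection graph (Laplacian `ℒ_cp = ℒ_C + ℒ_P`) is connected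
    (hcp : ∀ v : Fin N → ℝ, (LC + LP).mulVec v = 0 → ∃ c : ℝ, v = fun _ => c)
    (σI : ℝ) (hσI : 0 < σI)
    -- condition (i): `Ψ₁₁` invertible and `Ψ₁₁ + Ψ₁₁ᵀ` negative definite
    (hinv : IsUnit ((1 / (N : ℝ)) • ∑ k, A k).det)
    (hnegdef : (-(((1 / (N : ℝ)) • ∑ k, A k) +
      ((1 / (N : ℝ)) • ∑ k, A k).transpose)).PosDef)
    -- condition (ii): `λ₂(ℒ_cp) > (1/2)(μ/(N|η|) + ρ)`
    (hii : lambda2 (LC + LP) >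
      (1 / 2) *
        (lambdaMax (∑ j : Fin (N - 1),
            ((A (emb hN j) + (A (emb hN j)).transpose) -
              (A (e0 hN) + (A (e0 hN)).transpose)) ^ 2) /
          ((N : ℝ) *
            |lambdaMax (((1 / (N : ℝ)) • ∑ k, A k) +
              ((1 / (N : ℝ)) • ∑ k, A k).transpose)|) +
        Finset.univ.sup' ⟨e0 hN, Finset.mem_univ _⟩
          (fun k => lambdaMax (A k + (A k).transpose))))
    -- condition (iii): `λ₂(ℒ_I) > 0`
    (hiii : 0 < lambda2 LI)
    (x z : ℝ → Fin N × Fin n → ℝ)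
    (hx : ∀ t ∈ Set.Ici (0 : ℝ), HasDerivWithinAt x
      ((blockDiag A -
          ((LC + LP) ⊗ₖ (1 : Matrix (Fin n) (Fin n) ℝ))).mulVec (x t) +
        z t + fun p => b p.1 p.2) (Set.Ici 0) t)
    (hz : ∀ t ∈ Set.Ici (0 : ℝ), HasDerivWithinAt z
      (-(σI • ((LI ⊗ₖ (1 : Matrix (Fin n) (Fin n) ℝ)).mulVec (x t))))
      (Set.Ici 0) t)
    (hz0 : z 0 = 0) :
    Filter.Tendsto x Filter.atTop
      (nhds (fun p => (-((1 / (N : ℝ)) •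
        ((((1 / (N : ℝ)) • ∑ k, A k)⁻¹).mulVec (∑ k, b k)))) p.2)) ∧
    ∃ W : ℝ, ∀ t ∈ Set.Ici (0 : ℝ), ‖z t‖ ≤ W := by
  have hL := hLC.add hLP
  have hN0 : (N : ℝ) ≠ 0 := by exact_mod_cast (by omega : N ≠ 0)
  set Ψ : Matrix (Fin n) (Fin n) ℝ := (1 / (N : ℝ)) • ∑ k, A k with hΨ
  obtain ⟨c, hc, hQ⟩ := exists_dotProduct_closedLoop_le hN hn A hL hΨ hnegdef rfl
    (fun k => Finset.le_sup' (fun k => lambdaMax (A k + (A k)ᵀ)) (Finset.mem_univ k)) hii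
  obtain ⟨G, hG, hGL⟩ := hLI.1.exists_posDef_mul_eq (by omega) hiii
  set M := _root_.blockDiag A - (LC + LP) ⊗ₖ (1 : Matrix (Fin n) (Fin n) ℝ) with hM
  set xinf : Fin n → ℝ := -((1 / (N : ℝ)) • (Ψ⁻¹ *ᵥ ∑ k, b k)) with hxinf
  set xs : Fin N × Fin n → ℝ := fun p => xinf p.2 with hxs
  set bb : Fin N × Fin n → ℝ := fun p => b p.1 p.2 with hbb
  set zs : Fin N × Fin n → ℝ := -(_root_.blockDiag A *ᵥ xs + bb) with hzs
  have hker : ∀ {L : Matrix (Fin N) (Fin N) ℝ}, IsLaplacian L →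
      (L ⊗ₖ (1 : Matrix (Fin n) (Fin n) ℝ)) *ᵥ xs = 0 := by
    intro L h
    ext p
    rw [kronecker_one_mulVec_apply]
    exact congrFun (h.mulVec_const (xinf p.2)) p.1
  have hMxs : M *ᵥ xs + zs + bb = 0 := by
    rw [hM, sub_mulVec, hker hL, hzs]
    abel
  have hzs_sum : ∀ j, ∑ k, zs (k, j) = 0 := by
    have h1 : (∑ k, A k) *ᵥ xinf = -∑ k, b k := by
      have h2 : ∑ k, A k = (N : ℝ) • Ψ := by
        rw [hΨ, smul_smul, mul_one_div_cancel hN0, one_smul]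
      rw [h2, hxinf, mulVec_neg, mulVec_smul, smul_mulVec, mulVec_mulVec,
        mul_nonsing_inv _ hinv, one_mulVec, smul_smul, one_div_mul_cancel hN0, one_smul]
    intro j
    have h3 := congrFun h1 j
    rw [sum_mulVec] at h3
    simp only [Finset.sum_apply, Pi.neg_apply] at h3
    simp only [hzs, Pi.neg_apply, Pi.add_apply, blockDiag_mulVec_apply, hxs, hbb,
      Finset.sum_neg_distrib, Finset.sum_add_distrib]
    linarith
  have hz_sum : ∀ t ∈ Set.Ici (0 : ℝ), ∀ j, ∑ k, z t (k, j) = 0 := by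
    intro t ht j
    have hd : ∀ s ∈ Set.Ici (0 : ℝ),
        HasDerivWithinAt (fun t => ∑ k, z t (k, j)) 0 (Set.Ici 0) s := by
      intro s hs
      have h := hasDerivWithinAt_pi.1 (hz s hs)
      refine (HasDerivWithinAt.fun_sum (u := Finset.univ) fun k _ => h (k, j)).congr_deriv ?_
      have h1 : (fun _ : Fin N => (1 : ℝ)) ⬝ᵥ LI *ᵥ (fun k => x s (k, j)) = 0 := by
        rw [← hLI.1.transpose_eq, dotProduct_transpose_mulVec, hLI.1.mulVec_const,
          dotProduct_zero]
      simp only [dotProduct, one_mul] at h1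
      simp only [Pi.neg_apply, Pi.smul_apply, smul_eq_mul, kronecker_one_mulVec_apply,
        Finset.sum_neg_distrib, ← Finset.mul_sum, h1, mul_zero, neg_zero]
    have h0 := constant_of_has_deriv_right_zero (a := 0) (b := t)
      (fun s hs => (hd s hs.1).continuousWithinAt.mono Set.Icc_subset_Ici_self)
      (fun s hs => (hd s hs.1).mono (Set.Ici_subset_Ici.2 hs.1)) t ⟨ht, le_rfl⟩
    simpa [hz0] using h0
  have he : ∀ t ∈ Set.Ici (0 : ℝ), HasDerivWithinAt (fun t => x t - xs)
      (M *ᵥ (x t - xs) + (z t - zs)) (Set.Ici 0) t := by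
    intro t ht
    refine ((hx t ht).sub_const xs).congr_deriv ?_
    rw [mulVec_sub, ← sub_zero (M *ᵥ x t + z t + bb), ← hMxs]
    abel
  have hw : ∀ t ∈ Set.Ici (0 : ℝ), HasDerivWithinAt (fun t => z t - zs)
      (-((σI • (LI ⊗ₖ (1 : Matrix (Fin n) (Fin n) ℝ))) *ᵥ (x t - xs))) (Set.Ici 0) t := by
    intro t ht
    refine ((hz t ht).sub_const zs).congr_deriv ?_
    rw [smul_mulVec, mulVec_sub, hker hLI.1, sub_zero]
  obtain ⟨C, a, ha, hbound⟩ := exists_exp_bound_of_feedback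
    (H := σI⁻¹ • (G ⊗ₖ (1 : Matrix (Fin n) (Fin n) ℝ)))
    ((hG.kronecker PosDef.one).smul (inv_pos.2 hσI)) hc hQ he hw fun t ht => by
      rw [smul_mulVec, smul_mulVec, mulVec_smul, smul_smul, inv_mul_cancel₀ hσI.ne', one_smul,
        mulVec_mulVec, ← mul_kronecker_mul, one_mul, hGL, dotProduct_kronecker_one_mulVec,
        dotProduct, Fintype.sum_prod_type_right]
      refine Finset.sum_congr rfl fun j _ => ?_
      have h0 : ∑ k, (z t - zs) (k, j) = 0 := by
        simp [Finset.sum_sub_distrib, hz_sum t ht j, hzs_sum j]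
      have h1 : (fun k => (z t - zs) (k, j)) ⬝ᵥ
          (of fun _ _ => (1 : ℝ)) *ᵥ (fun k => (x t - xs) (k, j)) = 0 := by
        simp only [mulVec, dotProduct, of_apply, one_mul, ← Finset.sum_mul, h0, zero_mul]
      rw [sub_mulVec, one_mulVec, smul_mulVec, dotProduct_sub, dotProduct_smul, h1, smul_zero,
        sub_zero]
      rfl
  have hcoord : ∀ t ∈ Set.Ici (0 : ℝ), ∀ p, |x t p - xs p| ≤ √(C * Real.exp (-a * t)) ∧
      |z t p - zs p| ≤ √(C * Real.exp (-a * t)) := by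
    intro t ht p
    have hsq : ∀ v : Fin N × Fin n → ℝ, v p ^ 2 ≤ v ⬝ᵥ v := fun v => by
      rw [sq]
      exact Finset.single_le_sum (f := fun q => v q * v q) (fun q _ => mul_self_nonneg _)
        (Finset.mem_univ p)
    have h := hbound t ht
    constructor
    · refine Real.abs_le_sqrt ((hsq (x t - xs)).trans ?_)
      linarith [dotProduct_self_nonneg' (z t - zs)]
    · refine Real.abs_le_sqrt ((hsq (z t - zs)).trans ?_)
      linarith [dotProduct_self_nonneg' (x t - xs)]
  constructor
  · rw [tendsto_pi_nhds]
    intro p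
    rw [tendsto_iff_norm_sub_tendsto_zero]
    have hexp : Filter.Tendsto (fun t : ℝ => √(C * Real.exp (-a * t))) Filter.atTop (nhds 0) := by
      have h1 : Filter.Tendsto (fun t : ℝ => -a * t) Filter.atTop Filter.atBot :=
        Filter.tendsto_id.const_mul_atTop_of_neg (neg_neg_of_pos ha)
      have h2 := ((Real.tendsto_exp_atBot.comp h1).const_mul C).sqrt
      simpa using h2
    refine squeeze_zero' (Filter.Eventually.of_forall fun t => norm_nonneg _) ?_ hexp
    filter_upwards [Filter.eventually_ge_atTop 0] with t ht
    exact (hcoord t ht p).1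
  · refine ⟨√|C| + ‖zs‖, fun t ht => (pi_norm_le_iff_of_nonneg (by positivity)).2 fun p => ?_⟩
    have h1 : C * Real.exp (-a * t) ≤ |C| := by
      have h2 : Real.exp (-a * t) ≤ 1 :=
        Real.exp_le_one_iff.2 (by nlinarith [Set.mem_Ici.1 ht])
      calc C * Real.exp (-a * t) ≤ |C| * Real.exp (-a * t) :=
            mul_le_mul_of_nonneg_right (le_abs_self C) (Real.exp_pos _).le
        _ ≤ |C| := mul_le_of_le_one_right (abs_nonneg C) h2
    calc ‖z t p‖ = ‖(z t p - zs p) + zs p‖ := by rw [sub_add_cancel]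
      _ ≤ ‖z t p - zs p‖ + ‖zs p‖ := norm_add_le _ _
      _ ≤ √|C| + ‖zs‖ :=
        add_le_add ((hcoord t ht p).2.trans (Real.sqrt_le_sqrt h1)) (norm_le_pi_norm zs p)

end
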